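/- Fix p ∈ (0,1). There exist constants c1, c2 ∈ (0,∞) such that for every n ≥ 2 and every t > 0, under the Erdős–Rényi measure G(n,p), the probability that | Σ_{i=1}^n (K_i − Θ)² − σ² n(n−1) | ≥ t is at most c2 · exp(−c1 · t / n^{3/2}), where Θ = (n−1)p and σ² = p(1−p). -/

import Mathlib

open scoped Classical
open Finset

/-- The real adjacency matrix of a simple graph on `Fin n`. -/
noncomputable def adjMat {n : ℕ} (g : SimpleGraph (Fin n)) : Matrix (Fin n) (Fin n) ℝ :=
  g.adjMatrix ℝ

/-- The number of edges of a simple graph on `Fin n`. -/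
noncomputable def edgeCount {n : ℕ} (g : SimpleGraph (Fin n)) : ℕ := g.edgeFinset.card

/-- The Erdős–Rényi `G(n,p)` probability of a single graph `g`:
`p ^ m (1-p) ^ (C(n,2) - m)` where `m` is the number of edges of `g`. -/
noncomputable def erWeight (n : ℕ) (p : ℝ) (g : SimpleGraph (Fin n)) : ℝ :=
  p ^ edgeCount g * (1 - p) ^ (n.choose 2 - edgeCount g)

/-- The Erdős–Rényi `G(n,p)` probability of a set `S` of graphs on `Fin n`. -/
noncomputable def erProb (n : ℕ) (p : ℝ) (S : Set (SimpleGraph (Fin n))) : ℝ :=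
  ∑ g : SimpleGraph (Fin n), if g ∈ S then erWeight n p g else 0

/-- The degree `K_i(g) = Σ_j A_{ij}(g)` of vertex `i`, as a real number. -/
noncomputable def degR {n : ℕ} (g : SimpleGraph (Fin n)) (i : Fin n) : ℝ :=
  ∑ j, adjMat g i j

/-- Expectation of `F` at a random subset of `S` containing each element independently with
probability `p`. -/
noncomputable def subsetExp {E : Type*} (p : ℝ) (S : Finset E) (F : Finset E → ℝ) : ℝ :=
  ∑ s ∈ S.powerset, p ^ #s * (1 - p) ^ (#S - #s) * F s

/-- The centred indicator of `e ∈ s`. -/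
noncomputable def centredInd {E : Type*} [DecidableEq E] (p : ℝ) (e : E) (s : Finset E) : ℝ :=
  (if e ∈ s then 1 else 0) - p

section RandomSubset

variable {E : Type*} {p : ℝ}

lemma subsetExp_mono (hp : p ∈ Set.Ioo (0 : ℝ) 1) {S : Finset E} {F G : Finset E → ℝ}
    (h : ∀ s ⊆ S, F s ≤ G s) : subsetExp p S F ≤ subsetExp p S G := by
  refine sum_le_sum fun s hs => mul_le_mul_of_nonneg_left (h s (mem_powerset.1 hs)) ?_
  have h0 : 0 < 1 - p := by linarith [hp.2]
  have h1 := hp.1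
  positivity

lemma subsetExp_add (S : Finset E) (F G : Finset E → ℝ) :
    subsetExp p S (fun s => F s + G s) = subsetExp p S F + subsetExp p S G := by
  simp only [subsetExp, mul_add, sum_add_distrib]

lemma subsetExp_const_mul (S : Finset E) (c : ℝ) (F : Finset E → ℝ) :
    subsetExp p S (fun s => c * F s) = c * subsetExp p S F := by
  simp only [subsetExp, mul_sum]
  exact sum_congr rfl fun s _ => by ring

lemma subsetExp_sum {ι : Type*} (S : Finset E) (T : Finset ι) (F : ι → Finset E → ℝ) :
    subsetExp p S (fun s => ∑ i ∈ T, F i s) = ∑ i ∈ T, subsetExp p S (F i) := by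
  simp only [subsetExp, mul_sum]
  exact sum_comm

variable [DecidableEq E]

lemma subsetExp_insert {S : Finset E} {a : E} (ha : a ∉ S) (F : Finset E → ℝ) :
    subsetExp p (insert a S) F =
      subsetExp p S (fun s => (1 - p) * F s + p * F (insert a s)) := by
  simp only [subsetExp]
  rw [sum_powerset_insert ha, ← sum_add_distrib]
  refine sum_congr rfl fun s hs => ?_
  have hs' := mem_powerset.1 hs
  have hcard : #s ≤ #S := card_le_card hs'
  rw [card_insert_of_notMem ha, card_insert_of_notMem (fun h => ha (hs' h)),
    show #S + 1 - #s = (#S - #s) + 1 by omega, show #S + 1 - (#s + 1) = #S - #s by omega]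
  ring

lemma centredInd_insert_self (a : E) (s : Finset E) : centredInd p a (insert a s) = 1 - p := by
  simp [centredInd]

lemma centredInd_of_notMem {a : E} {s : Finset E} (ha : a ∉ s) : centredInd p a s = -p := by
  simp [centredInd, ha]

lemma centredInd_insert_of_ne {a e : E} (h : e ≠ a) (s : Finset E) :
    centredInd p e (insert a s) = centredInd p e s := by
  simp [centredInd, h]

lemma centredInd_sq (e : E) (s : Finset E) :
    centredInd p e s ^ 2 = (1 - 2 * p) * centredInd p e s + p * (1 - p) := by
  unfold centredInd
  split_ifs <;> ring

lemma exp_le_add_exp_sq (y : ℝ) : Real.exp y ≤ y + Real.exp (y ^ 2) := by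
  have h2 := Real.add_one_le_exp (y ^ 2)
  rcases le_or_gt |y| 1 with h | h
  · have := (abs_le.1 (Real.abs_exp_sub_one_sub_id_le h)).2
    linarith
  · rcases lt_abs.1 h with h | h
    · have : Real.exp y ≤ Real.exp (y ^ 2) := Real.exp_le_exp.2 (by nlinarith)
      linarith
    · have : Real.exp y ≤ 1 := Real.exp_le_one_iff.2 (by linarith)
      nlinarith

lemma bernoulli_mgf_le (hp : p ∈ Set.Ioo (0 : ℝ) 1) (y : ℝ) :
    (1 - p) * Real.exp (-p * y) + p * Real.exp ((1 - p) * y) ≤ Real.exp (y ^ 2) := by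
  obtain ⟨h0, h1⟩ := hp
  have e1 : Real.exp ((-p * y) ^ 2) ≤ Real.exp (y ^ 2) :=
    Real.exp_le_exp.2 (by
      nlinarith [sq_nonneg y, mul_nonneg (sq_nonneg y) (by nlinarith : 0 ≤ 1 - p ^ 2)])
  have e2 : Real.exp (((1 - p) * y) ^ 2) ≤ Real.exp (y ^ 2) :=
    Real.exp_le_exp.2 (by
      nlinarith [sq_nonneg y, mul_nonneg (sq_nonneg y) (by nlinarith : 0 ≤ 1 - (1 - p) ^ 2)])
  have f1 := mul_le_mul_of_nonneg_left ((exp_le_add_exp_sq (-p * y)).trans (add_le_add_right e1 _))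
    (by linarith : 0 ≤ 1 - p)
  have f2 := mul_le_mul_of_nonneg_left
    ((exp_le_add_exp_sq ((1 - p) * y)).trans (add_le_add_right e2 _)) h0.le
  linarith

/-- Exponential moment of the square of a linear form. -/
lemma subsetExp_exp_sq_le (hp : p ∈ Set.Ioo (0 : ℝ) 1) (b : E → ℝ) (S : Finset E) :
    ∀ k : ℝ, 0 ≤ k → k * ∑ f ∈ S, b f ^ 2 ≤ 1 / 8 →
      subsetExp p S (fun s => Real.exp (k * (∑ f ∈ S, b f * centredInd p f s) ^ 2))
        ≤ Real.exp (2 * (k * ∑ f ∈ S, b f ^ 2)) := by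
  induction S using Finset.induction_on with
  | empty => intro k _ _; simp [subsetExp]
  | insert a S ha ih =>
    intro k hk hB
    rw [sum_insert ha] at hB ⊢
    set B := ∑ f ∈ S, b f ^ 2 with hBdef
    have hB0 : 0 ≤ B := sum_nonneg fun f _ => sq_nonneg _
    have hu : 0 ≤ k * B := mul_nonneg hk hB0
    have hv : 0 ≤ k * b a ^ 2 := mul_nonneg hk (sq_nonneg _)
    have huv : (k * B) * (k * b a ^ 2) ≤ (k * b a ^ 2) / 8 := by nlinarith
    have key := ih (k * (1 + 4 * (k * b a ^ 2))) (by positivity) (by nlinarith)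
    rw [subsetExp_insert ha]
    calc _ ≤ subsetExp p S (fun s => Real.exp (k * b a ^ 2) *
            Real.exp (k * (1 + 4 * (k * b a ^ 2)) * (∑ f ∈ S, b f * centredInd p f s) ^ 2)) := by
          refine subsetExp_mono hp fun s hs => ?_
          have has : a ∉ s := fun h => ha (hs h)
          have hins : ∑ f ∈ S, b f * centredInd p f (insert a s) =
              ∑ f ∈ S, b f * centredInd p f s := sum_congr rfl fun f hf => by
            rw [centredInd_insert_of_ne (ne_of_mem_of_not_mem hf ha) s]
          rw [sum_insert ha, sum_insert ha, centredInd_insert_self, centredInd_of_notMem has, hins]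
          set D := ∑ f ∈ S, b f * centredInd p f s
          have hm := bernoulli_mgf_le hp (2 * k * b a * D)
          have hx : ∀ x : ℝ, x ^ 2 ≤ 1 → Real.exp (k * (b a * x + D) ^ 2) ≤
              Real.exp (k * b a ^ 2 + k * D ^ 2) * Real.exp (x * (2 * k * b a * D)) := by
            intro x hx
            rw [← Real.exp_add]
            refine Real.exp_le_exp.2 ?_
            nlinarith [mul_nonneg hv (sub_nonneg.2 hx)]
          have h1 := mul_le_mul_of_nonneg_left (hx (-p) (by nlinarith [hp.1, hp.2]))
            (by linarith [hp.2] : 0 ≤ 1 - p)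
          have h2 := mul_le_mul_of_nonneg_left (hx (1 - p) (by nlinarith [hp.1, hp.2])) hp.1.le
          have h3 := mul_le_mul_of_nonneg_left hm (Real.exp_pos (k * b a ^ 2 + k * D ^ 2)).le
          calc _ ≤ Real.exp (k * b a ^ 2 + k * D ^ 2) * Real.exp ((2 * k * b a * D) ^ 2) := by
                linarith
            _ = _ := by
                rw [← Real.exp_add, ← Real.exp_add]
                ring_nf
      _ = Real.exp (k * b a ^ 2) * _ := subsetExp_const_mul _ _ _
      _ ≤ Real.exp (k * b a ^ 2) * _ := mul_le_mul_of_nonneg_left key (Real.exp_pos _).le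
      _ ≤ _ := by
          rw [← Real.exp_add]
          refine Real.exp_le_exp.2 ?_
          nlinarith

/-- Exponential supermartingale bound for a martingale transform of centred indicators, revealed
in the order given by `r`. -/
lemma subsetExp_exp_transform_le_one (hp : p ∈ Set.Ioo (0 : ℝ) 1) (r : E → ℕ)
    (D : E → Finset E → ℝ) (hD : ∀ e a s, r e ≤ r a → D e (insert a s) = D e s)
    (S : Finset E) :
    subsetExp p S (fun s => Real.exp (∑ e ∈ S, (centredInd p e s * D e s - D e s ^ 2))) ≤ 1 := by
  induction S using Finset.induction_on_max_value r with
  | empty => simp [subsetExp]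
  | insert a S ha hmax ih =>
    rw [subsetExp_insert ha]
    refine (subsetExp_mono hp fun s hs => ?_).trans ih
    have has : a ∉ s := fun h => ha (hs h)
    have hins : ∑ e ∈ S, (centredInd p e (insert a s) * D e (insert a s) - D e (insert a s) ^ 2) =
        ∑ e ∈ S, (centredInd p e s * D e s - D e s ^ 2) := sum_congr rfl fun f hf => by
      rw [centredInd_insert_of_ne (ne_of_mem_of_not_mem hf ha) s, hD f a s (hmax f hf)]
    rw [sum_insert ha, sum_insert ha, centredInd_insert_self, centredInd_of_notMem has,
      hD a a s le_rfl, hins]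
    set W := ∑ e ∈ S, (centredInd p e s * D e s - D e s ^ 2)
    have hm := mul_le_mul_of_nonneg_left (bernoulli_mgf_le hp (D a s))
      (Real.exp_pos (W - D a s ^ 2)).le
    have h1 : Real.exp (-p * D a s - D a s ^ 2 + W) =
        Real.exp (W - D a s ^ 2) * Real.exp (-p * D a s) := by
      rw [← Real.exp_add]; ring_nf
    have h2 : Real.exp ((1 - p) * D a s - D a s ^ 2 + W) =
        Real.exp (W - D a s ^ 2) * Real.exp ((1 - p) * D a s) := by
      rw [← Real.exp_add]; ring_nf
    have h3 : Real.exp (W - D a s ^ 2) * Real.exp (D a s ^ 2) = Real.exp W := by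
      rw [← Real.exp_add]; ring_nf
    rw [h1, h2]
    linarith

lemma exp_sum_le_average {ι : Type*} (T : Finset ι) (hT : T.Nonempty) (y : ι → ℝ) :
    Real.exp (∑ i ∈ T, y i) ≤ (#T : ℝ)⁻¹ * ∑ i ∈ T, Real.exp (#T * y i) := by
  have hc : (0 : ℝ) < #T := by exact_mod_cast hT.card_pos
  have h := convexOn_exp.map_sum_le (t := T) (w := fun _ => (#T : ℝ)⁻¹)
    (p := fun i => #T * y i) (fun _ _ => by positivity) (by simp [hc.ne']) (fun _ _ => trivial)
  simp only [smul_eq_mul, ← mul_sum] at h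
  rwa [inv_mul_cancel_left₀ hc.ne'] at h

/-- Exponential moment of a martingale transform, from the exponential moments of the squared
multipliers. -/
lemma subsetExp_exp_transform_le (hp : p ∈ Set.Ioo (0 : ℝ) 1) (r : E → ℕ)
    (D : E → Finset E → ℝ) (hD : ∀ e a s, r e ≤ r a → D e (insert a s) = D e s)
    (S : Finset E) (hS : S.Nonempty) (l M : ℝ)
    (hM : ∀ e ∈ S, subsetExp p S (fun s => Real.exp (#S * (4 * l ^ 2 * D e s ^ 2))) ≤ M) :
    subsetExp p S (fun s => Real.exp (l * ∑ e ∈ S, centredInd p e s * D e s)) ≤ (1 + M) / 2 := by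
  have hc : (0 : ℝ) < #S := by exact_mod_cast hS.card_pos
  have h1 := subsetExp_exp_transform_le_one hp r (fun e s => 2 * l * D e s)
    (fun e a s h => by simp only [hD e a s h]) S
  have h2 : subsetExp p S (fun s => Real.exp (∑ e ∈ S, 4 * l ^ 2 * D e s ^ 2)) ≤ M := by
    refine (subsetExp_mono hp fun s _ => exp_sum_le_average S hS _).trans ?_
    rw [subsetExp_const_mul, subsetExp_sum, inv_mul_le_iff₀ hc, ← nsmul_eq_mul]
    exact sum_le_card_nsmul S _ M hM
  have h3 : subsetExp p S (fun s => Real.exp (l * ∑ e ∈ S, centredInd p e s * D e s)) ≤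
      subsetExp p S (fun s => 2⁻¹ *
        (Real.exp (∑ e ∈ S, (centredInd p e s * (2 * l * D e s) - (2 * l * D e s) ^ 2)) +
        Real.exp (∑ e ∈ S, 4 * l ^ 2 * D e s ^ 2))) := by
    refine subsetExp_mono hp fun s _ => ?_
    have hsplit : 2 * (l * ∑ e ∈ S, centredInd p e s * D e s) =
        ∑ e ∈ S, (centredInd p e s * (2 * l * D e s) - (2 * l * D e s) ^ 2) +
          ∑ e ∈ S, 4 * l ^ 2 * D e s ^ 2 := by
      rw [← sum_add_distrib, ← mul_assoc, mul_sum]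
      exact sum_congr rfl fun e _ => by ring
    set a := ∑ e ∈ S, (centredInd p e s * (2 * l * D e s) - (2 * l * D e s) ^ 2)
    set b := ∑ e ∈ S, 4 * l ^ 2 * D e s ^ 2
    rw [show l * ∑ e ∈ S, centredInd p e s * D e s = a / 2 + b / 2 by linarith, Real.exp_add]
    have ha : Real.exp a = Real.exp (a / 2) ^ 2 := by rw [← Real.exp_nat_mul]; ring_nf
    have hb : Real.exp b = Real.exp (b / 2) ^ 2 := by rw [← Real.exp_nat_mul]; ring_nf
    rw [ha, hb]
    nlinarith [sq_nonneg (Real.exp (a / 2) - Real.exp (b / 2))]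
  rw [subsetExp_const_mul, subsetExp_add] at h3
  linarith

end RandomSubset

lemma sum_sum_eq_diag_add_two_mul {E : Type*} (r : E → ℕ) (hr : Function.Injective r)
    (S : Finset E) (h : E → E → ℝ) (hsymm : ∀ e f, h e f = h f e) :
    ∑ e ∈ S, ∑ f ∈ S, h e f =
      ∑ e ∈ S, h e e + 2 * ∑ e ∈ S, ∑ f ∈ S, if r f < r e then h e f else 0 := by
  have hpt : ∀ e f, h e f = (if e = f then h e f else 0) + (if r f < r e then h e f else 0) +
      (if r e < r f then h f e else 0) := by
    intro e f
    rcases lt_trichotomy (r e) (r f) with hlt | heq | hgt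
    · have : e ≠ f := fun H => by simp [H] at hlt
      simp [hlt, this, hlt.not_gt, hsymm e f]
    · simp [hr heq]
    · have : e ≠ f := fun H => by simp [H] at hgt
      simp [hgt, this, hgt.not_gt]
  have hdiag : ∑ e ∈ S, ∑ f ∈ S, (if e = f then h e f else 0) = ∑ e ∈ S, h e e :=
    sum_congr rfl fun e he => by simp [he]
  have hswap : ∑ e ∈ S, ∑ f ∈ S, (if r e < r f then h f e else 0) =
      ∑ e ∈ S, ∑ f ∈ S, (if r f < r e then h e f else 0) := sum_comm
  rw [sum_congr rfl fun e _ => sum_congr rfl fun f _ => hpt e f]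
  simp only [sum_add_distrib]
  rw [hdiag, hswap]
  ring

section CompleteGraph

variable {n : ℕ} {p : ℝ}

/-- The edges of the complete graph on `Fin n`. -/
noncomputable def allEdges (n : ℕ) : Finset (Sym2 (Fin n)) :=
  (⊤ : SimpleGraph (Fin n)).edgeFinset

/-- The number of vertices common to `e` and `f`. -/
noncomputable def commonVertices (e f : Sym2 (Fin n)) : ℝ :=
  ∑ i, (if i ∈ e then 1 else 0) * (if i ∈ f then 1 else 0)

lemma mk_mem_allEdges {i j : Fin n} : s(i, j) ∈ allEdges n ↔ i ≠ j := by
  simp [allEdges]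

lemma card_allEdges (n : ℕ) : #(allEdges n) = n.choose 2 := by
  have h := SimpleGraph.card_edgeFinset_top_eq_card_choose_two (V := Fin n)
  rw [Fintype.card_fin] at h
  rw [← h, allEdges]

lemma cast_card_allEdges (n : ℕ) : (#(allEdges n) : ℝ) = n * (n - 1) / 2 := by
  rw [card_allEdges, Nat.cast_choose_two]

lemma sum_edges_at (i : Fin n) (F : Sym2 (Fin n) → ℝ) :
    ∑ e ∈ allEdges n, (if i ∈ e then F e else 0) = ∑ j, if i ≠ j then F s(i, j) else 0 := by
  rw [← sum_filter, ← sum_filter]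
  symm
  refine sum_bij (fun j _ => s(i, j)) ?_ ?_ ?_ ?_
  · intro j hj
    simpa [mk_mem_allEdges] using hj
  · intro j _ k _ h
    exact Sym2.congr_right.1 h
  · intro e he
    obtain ⟨he, j, rfl⟩ := mem_filter.1 he
    exact ⟨j, by simpa [mk_mem_allEdges] using he, rfl⟩
  · intro j _
    rfl

lemma sum_ne_const (i : Fin n) (c : ℝ) : (∑ j, if i ≠ j then c else 0) = (n - 1) * c := by
  have h : ∀ j, (if i ≠ j then c else 0) = c - if i = j then c else 0 := by
    intro j; split_ifs <;> simp_all
  simp only [h, sum_sub_distrib, sum_ite_eq, mem_univ, if_true, sum_const, card_univ,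
    Fintype.card_fin, nsmul_eq_mul]
  ring

lemma degR_sub_eq (g : SimpleGraph (Fin n)) (i : Fin n) :
    degR g i - (n - 1 : ℝ) * p =
      ∑ e ∈ allEdges n, if i ∈ e then centredInd p e g.edgeFinset else 0 := by
  rw [sum_edges_at, ← sum_ne_const i p, degR, ← sum_sub_distrib]
  refine sum_congr rfl fun j _ => ?_
  by_cases hij : i = j
  · subst hij
    simp [adjMat]
  · simp [adjMat, centredInd, hij, SimpleGraph.adjMatrix_apply]

lemma sum_mem_eq_two {e : Sym2 (Fin n)} (he : e ∈ allEdges n) :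
    (∑ i, if i ∈ e then (1 : ℝ) else 0) = 2 := by
  induction e using Sym2.ind with
  | _ a b =>
    have hab := mk_mem_allEdges.1 he
    have h : ∀ i, (if i ∈ s(a, b) then (1 : ℝ) else 0) =
        (if i = a then 1 else 0) + (if i = b then 1 else 0) := by
      intro i
      by_cases h1 : i = a
      · subst h1; simp [hab]
      · simp [h1]
    simp only [h, sum_add_distrib, sum_ite_eq', mem_univ, if_true]
    norm_num

lemma commonVertices_comm (e f : Sym2 (Fin n)) : commonVertices e f = commonVertices f e :=
  sum_congr rfl fun _ _ => mul_comm _ _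

lemma commonVertices_nonneg (e f : Sym2 (Fin n)) : 0 ≤ commonVertices e f :=
  sum_nonneg fun _ _ => by positivity

lemma commonVertices_self {e : Sym2 (Fin n)} (he : e ∈ allEdges n) : commonVertices e e = 2 := by
  rw [← sum_mem_eq_two he]
  exact sum_congr rfl fun i _ => by simp

lemma commonVertices_le_two (e : Sym2 (Fin n)) {f : Sym2 (Fin n)} (hf : f ∈ allEdges n) :
    commonVertices e f ≤ 2 := by
  rw [← sum_mem_eq_two hf]
  refine sum_le_sum fun i _ => ?_
  split_ifs <;> norm_num

lemma sum_commonVertices {e : Sym2 (Fin n)} (he : e ∈ allEdges n) :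
    ∑ f ∈ allEdges n, commonVertices e f = 2 * (n - 1) := by
  unfold commonVertices
  rw [sum_comm]
  simp only [← mul_sum]
  have h : ∀ i : Fin n, ∑ f ∈ allEdges n, (if i ∈ f then (1 : ℝ) else 0) = n - 1 := fun i => by
    rw [sum_edges_at i fun _ => 1, sum_ne_const, mul_one]
  simp only [h]
  rw [← sum_mul, sum_mem_eq_two he]

lemma sum_commonVertices_sq_le {e : Sym2 (Fin n)} (he : e ∈ allEdges n) :
    ∑ f ∈ allEdges n, commonVertices e f ^ 2 ≤ 4 * n := by
  have h : ∑ f ∈ allEdges n, commonVertices e f ^ 2 ≤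
      ∑ f ∈ allEdges n, 2 * commonVertices e f := sum_le_sum fun f hf => by
    nlinarith [commonVertices_nonneg e f, commonVertices_le_two e hf]
  rw [← mul_sum, sum_commonVertices he] at h
  linarith

/-- An enumeration of the pairs of vertices. -/
noncomputable def edgeRank (e : Sym2 (Fin n)) : ℕ := Fintype.equivFin (Sym2 (Fin n)) e

lemma edgeRank_injective : Function.Injective (edgeRank (n := n)) := fun _ _ h =>
  (Fintype.equivFin _).injective (Fin.ext h)

/-- The coefficient of `f` in the multiplier of `e`. -/
noncomputable def earlierCommon (e f : Sym2 (Fin n)) : ℝ :=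
  if edgeRank f < edgeRank e then commonVertices e f else 0

/-- The multiplier of the centred indicator of `e` in the martingale decomposition of the centred
sum of squared degrees. -/
noncomputable def edgeMultiplier (p : ℝ) (e : Sym2 (Fin n)) (s : Finset (Sym2 (Fin n))) : ℝ :=
  2 * (1 - 2 * p) + 2 * ∑ f ∈ allEdges n, earlierCommon e f * centredInd p f s

lemma edgeMultiplier_insert (e a : Sym2 (Fin n)) (s : Finset (Sym2 (Fin n)))
    (h : edgeRank e ≤ edgeRank a) : edgeMultiplier p e (insert a s) = edgeMultiplier p e s := by
  unfold edgeMultiplier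
  congr 2
  refine sum_congr rfl fun f _ => ?_
  by_cases hf : f = a
  · subst hf
    simp [earlierCommon, h.not_gt]
  · rw [centredInd_insert_of_ne hf]

lemma degree_squares_eq_transform (g : SimpleGraph (Fin n)) :
    (∑ i, (degR g i - (n - 1 : ℝ) * p) ^ 2) - p * (1 - p) * n * (n - 1) =
      ∑ e ∈ allEdges n, centredInd p e g.edgeFinset * edgeMultiplier p e g.edgeFinset := by
  set x : Sym2 (Fin n) → ℝ := fun e => centredInd p e g.edgeFinset with hx
  have hquad : ∑ i, (degR g i - (n - 1 : ℝ) * p) ^ 2 =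
      ∑ e ∈ allEdges n, ∑ f ∈ allEdges n, x e * x f * commonVertices e f := by
    simp only [degR_sub_eq, sq, sum_mul_sum]
    rw [sum_comm]
    refine sum_congr rfl fun e _ => ?_
    rw [sum_comm]
    refine sum_congr rfl fun f _ => ?_
    rw [commonVertices, mul_sum]
    refine sum_congr rfl fun i _ => ?_
    split_ifs <;> simp [hx]
  have hdiag : ∑ e ∈ allEdges n, x e * x e * commonVertices e e =
      ∑ e ∈ allEdges n, x e * (2 * (1 - 2 * p)) + p * (1 - p) * n * (n - 1) := by
    have h : ∀ e ∈ allEdges n, x e * x e * commonVertices e e =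
        x e * (2 * (1 - 2 * p)) + 2 * (p * (1 - p)) := fun e he => by
      rw [commonVertices_self he, ← sq, hx]
      simp only [centredInd_sq]
      ring
    rw [sum_congr rfl h, sum_add_distrib, sum_const, nsmul_eq_mul, cast_card_allEdges]
    ring
  rw [hquad, sum_sum_eq_diag_add_two_mul edgeRank edgeRank_injective _ _
    (fun e f => by rw [commonVertices_comm]; ring), hdiag]
  simp only [edgeMultiplier, mul_add, sum_add_distrib]
  rw [add_right_comm, add_sub_cancel_right, mul_sum]
  congr 1
  refine sum_congr rfl fun e _ => ?_
  rw [mul_left_comm]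
  congr 1
  rw [mul_sum]
  refine sum_congr rfl fun f _ => ?_
  simp only [earlierCommon, hx]
  split_ifs <;> ring

lemma subsetExp_exp_edgeMultiplier_sq_le (hp : p ∈ Set.Ioo (0 : ℝ) 1) (hn : 2 ≤ n) {l : ℝ}
    (hl : l ^ 2 * n ^ 3 ≤ 1 / 1024) {e : Sym2 (Fin n)} (he : e ∈ allEdges n) :
    subsetExp p (allEdges n) (fun s =>
      Real.exp (#(allEdges n) * (4 * l ^ 2 * edgeMultiplier p e s ^ 2))) ≤ Real.exp 1 := by
  have hn' : (2 : ℝ) ≤ n := by exact_mod_cast hn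
  set m : ℝ := (#(allEdges n) : ℝ) with hm
  have hm0 : 0 ≤ m := by positivity
  have hmn : m ≤ n ^ 2 / 2 := by rw [hm, cast_card_allEdges]; nlinarith
  set c : ℝ := m * l ^ 2 with hc
  have hc0 : 0 ≤ c := by positivity
  have hcn : c * n ≤ 1 / 2048 := by
    have := mul_le_mul_of_nonneg_right hmn (by positivity : 0 ≤ l ^ 2 * (n : ℝ))
    nlinarith
  have hc1 : c ≤ 1 / 2048 := by nlinarith
  have hB : ∑ f ∈ allEdges n, earlierCommon e f ^ 2 ≤ 4 * n := by
    refine (sum_le_sum fun f _ => ?_).trans (sum_commonVertices_sq_le he)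
    unfold earlierCommon
    split_ifs
    · exact le_rfl
    · simpa using sq_nonneg (commonVertices e f)
  set B := ∑ f ∈ allEdges n, earlierCommon e f ^ 2
  have hcB : 32 * c * B ≤ 1 / 16 := by
    have := mul_le_mul_of_nonneg_left hB hc0
    linarith
  have key := subsetExp_exp_sq_le hp (earlierCommon e) (allEdges n) (32 * c) (by positivity)
    (by linarith)
  calc _ ≤ subsetExp p (allEdges n) (fun s => Real.exp (32 * c) * Real.exp
        (32 * c * (∑ f ∈ allEdges n, earlierCommon e f * centredInd p f s) ^ 2)) := by
        refine subsetExp_mono hp fun s _ => ?_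
        rw [← Real.exp_add]
        refine Real.exp_le_exp.2 ?_
        unfold edgeMultiplier
        set G := ∑ f ∈ allEdges n, earlierCommon e f * centredInd p f s
        have hp2 : (1 - 2 * p) ^ 2 ≤ 1 := by nlinarith [hp.1, hp.2]
        have hsq : (2 * (1 - 2 * p) + 2 * G) ^ 2 ≤ 8 + 8 * G ^ 2 := by
          nlinarith [sq_nonneg ((1 - 2 * p) - G)]
        have := mul_le_mul_of_nonneg_left hsq (by positivity : 0 ≤ 4 * c)
        calc _ = 4 * c * (2 * (1 - 2 * p) + 2 * G) ^ 2 := by rw [hc]; ring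
          _ ≤ _ := this
          _ = _ := by ring
    _ = Real.exp (32 * c) * _ := subsetExp_const_mul _ _ _
    _ ≤ Real.exp (32 * c) * _ := mul_le_mul_of_nonneg_left key (Real.exp_pos _).le
    _ ≤ _ := by
        rw [← Real.exp_add]
        exact Real.exp_le_exp.2 (by linarith)

lemma sum_erWeight_mul_le (hp : p ∈ Set.Ioo (0 : ℝ) 1) (F : Finset (Sym2 (Fin n)) → ℝ)
    (hF : ∀ s, 0 ≤ F s) :
    ∑ g : SimpleGraph (Fin n), erWeight n p g * F g.edgeFinset ≤
      subsetExp p (allEdges n) F := by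
  have hinj : Set.InjOn (fun g : SimpleGraph (Fin n) => g.edgeFinset)
      (univ : Finset (SimpleGraph (Fin n))) := fun g _ h _ H =>
    SimpleGraph.edgeFinset_inj.1 H
  have hp1 : 0 < 1 - p := by linarith [hp.2]
  have hp0 := hp.1
  rw [subsetExp, card_allEdges]
  calc _ = ∑ s ∈ (univ : Finset (SimpleGraph (Fin n))).image (fun g => g.edgeFinset),
        p ^ #s * (1 - p) ^ (n.choose 2 - #s) * F s := (sum_image hinj).symm
    _ ≤ _ := by
      refine sum_le_sum_of_subset_of_nonneg ?_ fun s _ _ => mul_nonneg (by positivity) (hF s)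
      intro s hs
      obtain ⟨g, -, rfl⟩ := mem_image.1 hs
      exact mem_powerset.2 (SimpleGraph.edgeFinset_mono le_top)

end CompleteGraph

/-- Concentration of `Σ_i (K_i - Θ)²` under the Erdős–Rényi measure `G(n,p)`:
there are constants `c₁, c₂ ∈ (0,∞)` such that, for all `n ≥ 2` and `t > 0`,
`P( |Σ_i (K_i - Θ)² - σ² n (n-1)| ≥ t ) ≤ c₂ exp(-c₁ t / n^{3/2})`,
where `Θ = (n-1)p` and `σ² = p(1-p)`. -/
theorem degree_square_sum_concentration
    (p : ℝ) (hp : p ∈ Set.Ioo (0 : ℝ) 1) :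
    ∃ c₁ c₂ : ℝ, 0 < c₁ ∧ 0 < c₂ ∧
      ∀ n : ℕ, 2 ≤ n → ∀ t : ℝ, 0 < t →
        erProb n p
            {g : SimpleGraph (Fin n) |
              t ≤ |(∑ i, (degR g i - (n - 1 : ℝ) * p) ^ 2)
                    - p * (1 - p) * n * (n - 1)|}
          ≤ c₂ * Real.exp (-c₁ * t / (n : ℝ) ^ ((3 : ℝ) / 2)) := by
  refine ⟨1 / 32, 4, by norm_num, by norm_num, fun n hn t _ => ?_⟩
  have hn0 : (0 : ℝ) < n := by exact_mod_cast (by omega : 0 < n)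
  set q : ℝ := (n : ℝ) ^ ((3 : ℝ) / 2) with hq
  have hq0 : 0 < q := Real.rpow_pos_of_pos hn0 _
  have hq2 : q ^ 2 = n ^ 3 := by
    rw [hq, ← Real.rpow_mul_natCast hn0.le]
    norm_num
  set l : ℝ := 1 / 32 / q with hl
  have hl0 : 0 < l := by positivity
  have hl2 : l ^ 2 * n ^ 3 ≤ 1 / 1024 := by
    rw [← hq2, hl]
    field_simp
    norm_num
  set Y : Finset (Sym2 (Fin n)) → ℝ := fun s =>
    ∑ e ∈ allEdges n, centredInd p e s * edgeMultiplier p e s with hY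
  have hne : (allEdges n).Nonempty :=
    ⟨s(⟨0, by omega⟩, ⟨1, by omega⟩), mk_mem_allEdges.2 (by simp [Fin.ext_iff])⟩
  have hmgf : ∀ k : ℝ, k ^ 2 * n ^ 3 ≤ 1 / 1024 →
      subsetExp p (allEdges n) (fun s => Real.exp (k * Y s)) ≤ (1 + Real.exp 1) / 2 :=
    fun k hk => subsetExp_exp_transform_le hp edgeRank (edgeMultiplier p)
      (fun e a s h => edgeMultiplier_insert e a s h) _ hne k _
      fun e he => subsetExp_exp_edgeMultiplier_sq_le hp hn hk he
  have hpos := hmgf l hl2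
  have hneg := hmgf (-l) (by rwa [neg_sq])
  have hw : ∀ g : SimpleGraph (Fin n), 0 ≤ erWeight n p g := fun g => by
    have h1 : 0 < 1 - p := by linarith [hp.2]
    have h0 := hp.1
    unfold erWeight
    positivity
  have htail := sum_erWeight_mul_le hp
    (fun s => Real.exp (-(l * t)) * (Real.exp (l * Y s) + Real.exp (-l * Y s)))
    (fun s => by positivity)
  rw [subsetExp_const_mul, subsetExp_add] at htail
  have hexp : -(1 / 32) * t / q = -(l * t) := by rw [hl]; ring
  rw [hexp]
  calc _ ≤ _ := by
        refine sum_le_sum fun g _ => ?_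
        split_ifs with hg
        · refine le_mul_of_one_le_right (hw g) ?_
          rw [Set.mem_ofPred_eq, degree_squares_eq_transform] at hg
          change t ≤ |Y g.edgeFinset| at hg
          have hlt := mul_le_mul_of_nonneg_left hg hl0.le
          rw [mul_add, ← Real.exp_add, ← Real.exp_add]
          rcases abs_cases (Y g.edgeFinset) with ⟨h, _⟩ | ⟨h, _⟩
          · rw [h] at hlt
            have := Real.one_le_exp (show 0 ≤ -(l * t) + l * Y g.edgeFinset by linarith)
            linarith [Real.exp_pos (-(l * t) + -l * Y g.edgeFinset)]
          · rw [h] at hlt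
            have := Real.one_le_exp (show 0 ≤ -(l * t) + -l * Y g.edgeFinset by linarith)
            linarith [Real.exp_pos (-(l * t) + l * Y g.edgeFinset)]
        · exact mul_nonneg (hw g) (by positivity)
    _ ≤ _ := htail
    _ ≤ Real.exp (-(l * t)) * 4 :=
        mul_le_mul_of_nonneg_left (by linarith [Real.exp_one_lt_three]) (Real.exp_pos _).le
    _ = _ := mul_comm _ _
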